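/- Let G be a Garside group of finite type and x ∈ G. If x^α ∈ SSS(x) and x^β ∈ SSS(x) for elements α, β ∈ G, then x^{α∧β} ∈ SSS(x). -/

import Mathlib

/-- A Garside structure of finite type on a group `G`: a submonoid `P` of positive
elements with `P ∩ P⁻¹ = {1}`, such that the prefix order `a ⪯ b ↔ a⁻¹ * b ∈ P` is a
lattice order (with meet `wedge` and join `vee`), together with a Garside element `Δ ∈ P`
whose set of prefixes (the simple elements) is finite and generates `G`, satisfying
`Δ⁻¹ P Δ = P`, and such that every nontrivial positive element has a finite norm. -/
structure GarsideStructure (G : Type*) [Group G] where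
  P : Set G
  one_mem : (1 : G) ∈ P
  mul_mem : ∀ {a b : G}, a ∈ P → b ∈ P → a * b ∈ P
  eq_one_of_mem_of_inv_mem : ∀ a : G, a ∈ P → a⁻¹ ∈ P → a = 1
  wedge : G → G → G
  vee : G → G → G
  wedge_le_left : ∀ a b : G, (wedge a b)⁻¹ * a ∈ P
  wedge_le_right : ∀ a b : G, (wedge a b)⁻¹ * b ∈ P
  le_wedge : ∀ a b c : G, c⁻¹ * a ∈ P → c⁻¹ * b ∈ P → c⁻¹ * wedge a b ∈ P
  le_vee_left : ∀ a b : G, a⁻¹ * vee a b ∈ P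
  le_vee_right : ∀ a b : G, b⁻¹ * vee a b ∈ P
  vee_le : ∀ a b c : G, a⁻¹ * c ∈ P → b⁻¹ * c ∈ P → (vee a b)⁻¹ * c ∈ P
  Δ : G
  Δ_mem : Δ ∈ P
  simples_finite : {s : G | s ∈ P ∧ s⁻¹ * Δ ∈ P}.Finite
  simples_generate : Subgroup.closure {s : G | s ∈ P ∧ s⁻¹ * Δ ∈ P} = (⊤ : Subgroup G)
  conj_Delta_mem : ∀ a : G, a ∈ P → Δ⁻¹ * a * Δ ∈ P
  mem_of_conj_Delta_mem : ∀ a : G, Δ⁻¹ * a * Δ ∈ P → a ∈ P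
  norm_bounded : ∀ x : G, x ∈ P → x ≠ 1 →
    ∃ n : ℕ, ∀ L : List G, (∀ a ∈ L, a ∈ P ∧ a ≠ 1) → L.prod = x → L.length ≤ n

namespace GarsideStructure

variable {G : Type*} [Group G] (gs : GarsideStructure G)

/-- The prefix order: `a ⪯ b`. -/
def pre (a b : G) : Prop := a⁻¹ * b ∈ gs.P

/-- The suffix order: `a ≽ b` (i.e. `b` is a suffix of `a`). -/
def rdvd (a b : G) : Prop := a * b⁻¹ ∈ gs.P

/-- Greatest common divisor with respect to the suffix order `≽` : `a ∧↰ b`. -/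
def rwedge (a b : G) : G := (gs.vee a⁻¹ b⁻¹)⁻¹

/-- Least common multiple with respect to the suffix order `≽` : `a ∨↰ b`. -/
def rvee (a b : G) : G := (gs.wedge a⁻¹ b⁻¹)⁻¹

/-- Simple elements: positive prefixes of `Δ`. -/
def simple (s : G) : Prop := s ∈ gs.P ∧ s⁻¹ * gs.Δ ∈ gs.P

/-- Atoms: nontrivial positive elements which cannot be decomposed in `P`. -/
def atom (a : G) : Prop := a ∈ gs.P ∧ a ≠ 1 ∧
  ∀ b c : G, b ∈ gs.P → c ∈ gs.P → a = b * c → b = 1 ∨ c = 1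

/-- `inf x` : the maximal integer `p` with `Δ^p ⪯ x`. -/
noncomputable def ginf (x : G) : ℤ := sSup {p : ℤ | gs.pre (gs.Δ ^ p) x}

/-- `sup x` : the minimal integer `p` with `x ⪯ Δ^p`. -/
noncomputable def gsup (x : G) : ℤ := sInf {p : ℤ | gs.pre x (gs.Δ ^ p)}

/-- Canonical length `ℓ(x) = sup(x) - inf(x)`. -/
noncomputable def glen (x : G) : ℤ := gs.gsup x - gs.ginf x

/-- `‖x‖` : the maximal number of factors in a decomposition of `x` as a product of
nontrivial positive elements. -/
noncomputable def gnorm (x : G) : ℕ :=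
  sSup {k : ℕ | ∃ L : List G, (∀ a ∈ L, a ∈ gs.P ∧ a ≠ 1) ∧ L.prod = x ∧ L.length = k}

/-- The summit infimum `inf_s(x)` : the maximum of `inf` over the conjugacy class of `x`. -/
noncomputable def ginfs (x : G) : ℤ :=
  sSup {p : ℤ | ∃ y : G, (∃ α : G, α⁻¹ * x * α = y) ∧ p = gs.ginf y}

/-- The summit supremum `sup_s(x)` : the minimum of `sup` over the conjugacy class of `x`. -/
noncomputable def gsups (x : G) : ℤ :=
  sInf {p : ℤ | ∃ y : G, (∃ α : G, α⁻¹ * x * α = y) ∧ p = gs.gsup y}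

/-- The preferred prefix `𝔭(x) = (xΔ^{-inf x}) ∧ (x⁻¹Δ^{sup x}) ∧ Δ`. -/
noncomputable def pp (x : G) : G :=
  gs.wedge (gs.wedge (x * gs.Δ ^ (-gs.ginf x)) (x⁻¹ * gs.Δ ^ gs.gsup x)) gs.Δ

/-- Cyclic (left) sliding `𝔰(x) = 𝔭(x)⁻¹ x 𝔭(x)`. -/
noncomputable def sl (x : G) : G := (gs.pp x)⁻¹ * x * gs.pp x

/-- The preferred suffix `𝔭↰(x) = (Δ^{-inf x}x) ∧↰ (Δ^{sup x}x⁻¹) ∧↰ Δ`. -/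
noncomputable def ps (x : G) : G :=
  gs.rwedge (gs.rwedge (gs.Δ ^ (-gs.ginf x) * x) (gs.Δ ^ gs.gsup x * x⁻¹)) gs.Δ

/-- Cyclic right sliding `𝔰↰(x) = 𝔭↰(x) x 𝔭↰(x)⁻¹`. -/
noncomputable def rsl (x : G) : G := gs.ps x * x * (gs.ps x)⁻¹

/-- The super summit set `SSS(x)` : conjugates of `x` with maximal infimum and minimal
supremum among all conjugates of `x`. -/
def SSS (x : G) : Set G :=
  {y | (∃ α : G, α⁻¹ * x * α = y) ∧
    ∀ z : G, (∃ α : G, α⁻¹ * x * α = z) → gs.ginf z ≤ gs.ginf y ∧ gs.gsup y ≤ gs.gsup z}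

/-- The set of sliding circuits `SC(x)` : conjugates `y` of `x` with `𝔰^m(y) = y` for
some `m ≥ 1`. -/
noncomputable def SC (x : G) : Set G :=
  {y | (∃ α : G, α⁻¹ * x * α = y) ∧ ∃ m : ℕ, 1 ≤ m ∧ (gs.sl)^[m] y = y}

/-- The transport `α^{(1)} = 𝔭(x)⁻¹ α 𝔭(x^α)` of `α` at `x`. -/
noncomputable def transport (x α : G) : G := (gs.pp x)⁻¹ * α * gs.pp (α⁻¹ * x * α)

/-- Iterated transport `α^{(i)}` of `α` at `x`: `α^{(0)} = α` and `α^{(i+1)}` is the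
transport of `α^{(i)}` at `𝔰^i(x)`. -/
noncomputable def transportIter (x α : G) : ℕ → G
  | 0 => α
  | i + 1 => gs.transport ((gs.sl)^[i] x) (transportIter x α i)

/-- `c` is the `⪯`-minimal element `c_s(y)` satisfying `s ⪯ c` and `y^c ∈ SC(x)`. -/
def IsMinSCConj (x y s c : G) : Prop :=
  gs.pre s c ∧ (c⁻¹ * y * c) ∈ gs.SC x ∧
    ∀ d : G, gs.pre s d → (d⁻¹ * y * d) ∈ gs.SC x → gs.pre c d

/-- `s` is an indecomposable conjugator starting at `u`: `u^s ∈ SC(x)`, `s ≠ 1` and there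
is no `t` with `1 ≺ t ≺ s` and `u^t ∈ SC(x)`. -/
def IsIndecomposableConjugator (x u s : G) : Prop :=
  (s⁻¹ * u * s) ∈ gs.SC x ∧ s ≠ 1 ∧
    ¬ ∃ t : G, (gs.pre 1 t ∧ t ≠ 1) ∧ (gs.pre t s ∧ t ≠ s) ∧ (t⁻¹ * u * t) ∈ gs.SC x

/-- `u` is the pullback of `s` at `y = 𝔰(z)` : the `⪯`-minimal positive element with
`z^u ∈ SSS(x)` and `s ⪯ u^{(1)}` (transport at `z`). -/
def IsPullback (x z s u : G) : Prop :=
  u ∈ gs.P ∧ (u⁻¹ * z * u) ∈ gs.SSS x ∧ gs.pre s (gs.transport z u) ∧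
    ∀ u' : G, u' ∈ gs.P → (u'⁻¹ * z * u') ∈ gs.SSS x → gs.pre s (gs.transport z u') →
      gs.pre u u'

/-- The pullback `s_{(1)}` of `s` at `y = 𝔰(z)`. -/
noncomputable def pullbackOne (x z s : G) : G :=
  @Classical.epsilon G ⟨1⟩ (fun u => gs.IsPullback x z s u)

/-- The `k`-fold pullback `s_{(k)}` of `s` at `y = 𝔰^k(z)` (an element at `z`):
`s_{(0)} = s` and `s_{(k+1)}` is the pullback at `𝔰(z)` (relative to `z`) of the `k`-fold
pullback of `s` at `𝔰^k(𝔰(z)) = y`. -/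
noncomputable def pullbackIter (x : G) : G → ℕ → G → G
  | _, 0, s => s
  | z, k + 1, s => gs.pullbackOne x z (pullbackIter x (gs.sl z) k s)

end GarsideStructure

namespace GarsideStructure

variable {G : Type*} [Group G] (gs : GarsideStructure G)

theorem zpow_conj_mem (n : ℤ) {a : G} (ha : a ∈ gs.P) :
    (gs.Δ ^ n)⁻¹ * a * gs.Δ ^ n ∈ gs.P := by
  induction n using Int.induction_on with
  | zero => simpa using ha
  | succ n ih =>
    have h := gs.conj_Delta_mem _ ih
    convert h using 1
    rw [zpow_add_one]
    group
  | pred n ih =>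
    apply gs.mem_of_conj_Delta_mem
    convert ih using 1
    rw [zpow_sub_one]
    group

theorem pre_trans {a b c : G} (hab : gs.pre a b) (hbc : gs.pre b c) : gs.pre a c := by
  have h := gs.mul_mem hab hbc
  unfold pre
  convert h using 1
  group

theorem pre_mul_zpow_right (n : ℤ) {a b : G} (h : gs.pre a b) :
    gs.pre (a * gs.Δ ^ n) (b * gs.Δ ^ n) := by
  have h' := gs.zpow_conj_mem n h
  unfold pre
  convert h' using 1
  group

theorem pre_zpow_iff (g : G) (n : ℤ) :
    gs.pre g (gs.Δ ^ n) ↔ gs.pre (gs.Δ ^ (-n)) g⁻¹ := by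
  constructor <;> intro h
  · have h' := gs.zpow_conj_mem (-n) h
    unfold pre
    convert h' using 1
    group
  · have h' := gs.zpow_conj_mem n h
    unfold pre
    convert h' using 1
    group

theorem pre_zpow_mul {g h : G} {p q : ℤ} (hg : gs.pre (gs.Δ ^ p) g)
    (hh : gs.pre (gs.Δ ^ q) h) : gs.pre (gs.Δ ^ (p + q)) (g * h) := by
  have h' := gs.mul_mem (gs.zpow_conj_mem q hg) hh
  unfold pre
  convert h' using 1
  rw [zpow_add]
  group

theorem exists_zpow_pre (g : G) : ∃ p : ℤ, gs.pre (gs.Δ ^ p) g := by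
  suffices h : (∃ p : ℤ, gs.pre (gs.Δ ^ p) g) ∧ ∃ p : ℤ, gs.pre (gs.Δ ^ p) g⁻¹ from h.1
  have hg : g ∈ Subgroup.closure {s : G | s ∈ gs.P ∧ s⁻¹ * gs.Δ ∈ gs.P} := by
    rw [gs.simples_generate]
    trivial
  induction hg using Subgroup.closure_induction with
  | mem s hs =>
    refine ⟨⟨0, by simpa [pre] using hs.1⟩, ⟨-1, ?_⟩⟩
    rw [← gs.pre_zpow_iff]
    simpa [pre] using hs.2
  | one => exact ⟨⟨0, by simpa [pre] using gs.one_mem⟩, ⟨0, by simpa [pre] using gs.one_mem⟩⟩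
  | mul g h _ _ ihg ihh =>
    obtain ⟨⟨p, hp⟩, p', hp'⟩ := ihg
    obtain ⟨⟨q, hq⟩, q', hq'⟩ := ihh
    refine ⟨⟨p + q, gs.pre_zpow_mul hp hq⟩, ⟨q' + p', ?_⟩⟩
    rw [mul_inv_rev]
    exact gs.pre_zpow_mul hq' hp'
  | inv g _ ih => exact ⟨ih.2, by simpa using ih.1⟩

theorem pow_Delta_mem (n : ℕ) : gs.Δ ^ n ∈ gs.P := by
  induction n with
  | zero => simpa using gs.one_mem
  | succ n ih =>
    rw [pow_succ]
    exact gs.mul_mem ih gs.Δ_mem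

theorem exists_not_pow_pre (hΔ : gs.Δ ≠ 1) {y : G} (hy : y ∈ gs.P) :
    ∃ n : ℕ, ∀ k : ℕ, gs.pre (gs.Δ ^ k) y → k ≤ n := by
  by_cases hy1 : y = 1
  · subst hy1
    refine ⟨0, fun k hk => ?_⟩
    by_contra hk0
    obtain ⟨m, rfl⟩ : ∃ m, k = m + 1 := ⟨k - 1, by omega⟩
    refine hΔ (gs.eq_one_of_mem_of_inv_mem _ gs.Δ_mem ?_)
    have h := gs.mul_mem (gs.pow_Delta_mem m) hk
    convert h using 1
    rw [pow_succ']
    group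
  · obtain ⟨n, hn⟩ := gs.norm_bounded y hy hy1
    refine ⟨n, fun k hk => ?_⟩
    by_cases hz : (gs.Δ ^ k)⁻¹ * y = 1
    · have h := hn (List.replicate k gs.Δ)
        (fun a ha => by rw [List.eq_of_mem_replicate ha]; exact ⟨gs.Δ_mem, hΔ⟩)
        (by rw [List.prod_replicate]; exact inv_mul_eq_one.mp hz)
      simpa using h
    · have h := hn (List.replicate k gs.Δ ++ [(gs.Δ ^ k)⁻¹ * y])
        (fun a ha => by
          rcases List.mem_append.mp ha with ha | ha
          · rw [List.eq_of_mem_replicate ha]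
            exact ⟨gs.Δ_mem, hΔ⟩
          · rw [List.mem_singleton.mp ha]
            exact ⟨hk, hz⟩)
        (by simp)
      simp at h
      omega

theorem bddAbove_zpow_pre (hΔ : gs.Δ ≠ 1) (g : G) :
    BddAbove {p : ℤ | gs.pre (gs.Δ ^ p) g} := by
  obtain ⟨q, hq⟩ := gs.exists_zpow_pre g
  obtain ⟨n, hn⟩ := gs.exists_not_pow_pre hΔ hq
  refine ⟨q + n, fun p (hp : gs.pre (gs.Δ ^ p) g) => ?_⟩
  by_contra! hlt
  have hle := hn (p - q).toNat (by
    have hpq : gs.Δ ^ (p - q).toNat = gs.Δ ^ (p - q) := by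
      rw [← zpow_natCast, Int.toNat_of_nonneg (by omega)]
    unfold pre at hp ⊢
    rw [hpq]
    convert hp using 1
    rw [zpow_sub]
    group)
  omega

theorem ginf_pre (hΔ : gs.Δ ≠ 1) (g : G) : gs.pre (gs.Δ ^ gs.ginf g) g :=
  Int.csSup_mem (gs.exists_zpow_pre g) (gs.bddAbove_zpow_pre hΔ g)

theorem le_ginf (hΔ : gs.Δ ≠ 1) {g : G} {p : ℤ} (h : gs.pre (gs.Δ ^ p) g) : p ≤ gs.ginf g :=
  le_csSup (gs.bddAbove_zpow_pre hΔ g) h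

theorem bddBelow_pre_zpow (hΔ : gs.Δ ≠ 1) (g : G) :
    BddBelow {p : ℤ | gs.pre g (gs.Δ ^ p)} := by
  obtain ⟨n, hn⟩ := gs.bddAbove_zpow_pre hΔ g⁻¹
  exact ⟨-n, fun p hp => neg_le.mp (hn ((gs.pre_zpow_iff g p).mp hp))⟩

theorem pre_gsup (hΔ : gs.Δ ≠ 1) (g : G) : gs.pre g (gs.Δ ^ gs.gsup g) := by
  refine Int.csInf_mem ?_ (gs.bddBelow_pre_zpow hΔ g)
  obtain ⟨p, hp⟩ := gs.exists_zpow_pre g⁻¹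
  exact ⟨-p, (gs.pre_zpow_iff g (-p)).mpr (by simpa using hp)⟩

theorem gsup_le (hΔ : gs.Δ ≠ 1) {g : G} {p : ℤ} (h : gs.pre g (gs.Δ ^ p)) : gs.gsup g ≤ p :=
  csInf_le (gs.bddBelow_pre_zpow hΔ g) h

theorem eq_one_of_Delta_eq_one (hΔ : gs.Δ = 1) (g : G) : g = 1 := by
  have hg : g ∈ Subgroup.closure {s : G | s ∈ gs.P ∧ s⁻¹ * gs.Δ ∈ gs.P} := by
    rw [gs.simples_generate]
    trivial
  rw [← Subgroup.mem_bot]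
  refine (Subgroup.closure_le ⊥).mpr (fun s hs => ?_) hg
  exact gs.eq_one_of_mem_of_inv_mem s hs.1 (by simpa [hΔ] using hs.2)

theorem zpow_pre_conj_iff (x α : G) (p : ℤ) :
    gs.pre (gs.Δ ^ p) (α⁻¹ * x * α) ↔ gs.pre (x⁻¹ * (α * gs.Δ ^ p)) α := by
  unfold pre
  simp only [mul_inv_rev, inv_inv, mul_assoc]

theorem conj_pre_zpow_iff (x α : G) (p : ℤ) :
    gs.pre (α⁻¹ * x * α) (gs.Δ ^ p) ↔ gs.pre (x * α) (α * gs.Δ ^ p) := by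
  unfold pre
  simp only [mul_inv_rev, inv_inv, mul_assoc]

theorem pre_mul_left (c : G) {a b : G} (h : gs.pre a b) : gs.pre (c * a) (c * b) := by
  simpa [pre, mul_assoc] using h

theorem zpow_pre_conj_wedge {x α β : G} {p : ℤ} (hα : gs.pre (gs.Δ ^ p) (α⁻¹ * x * α))
    (hβ : gs.pre (gs.Δ ^ p) (β⁻¹ * x * β)) :
    gs.pre (gs.Δ ^ p) ((gs.wedge α β)⁻¹ * x * gs.wedge α β) := by
  rw [zpow_pre_conj_iff] at hα hβ ⊢
  exact gs.le_wedge _ _ _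
    (gs.pre_trans (gs.pre_mul_left _ (gs.pre_mul_zpow_right p (gs.wedge_le_left α β))) hα)
    (gs.pre_trans (gs.pre_mul_left _ (gs.pre_mul_zpow_right p (gs.wedge_le_right α β))) hβ)

theorem conj_wedge_pre_zpow {x α β : G} {p : ℤ} (hα : gs.pre (α⁻¹ * x * α) (gs.Δ ^ p))
    (hβ : gs.pre (β⁻¹ * x * β) (gs.Δ ^ p)) :
    gs.pre ((gs.wedge α β)⁻¹ * x * gs.wedge α β) (gs.Δ ^ p) := by
  rw [conj_pre_zpow_iff] at hα hβ ⊢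
  have h : gs.pre (x * gs.wedge α β * gs.Δ ^ (-p)) (gs.wedge α β) := by
    refine gs.le_wedge _ _ _ ?_ ?_
    · simpa [pre] using gs.pre_mul_zpow_right (-p)
        (gs.pre_trans (gs.pre_mul_left x (gs.wedge_le_left α β)) hα)
    · simpa [pre] using gs.pre_mul_zpow_right (-p)
        (gs.pre_trans (gs.pre_mul_left x (gs.wedge_le_right α β)) hβ)
  simpa using gs.pre_mul_zpow_right p h

end GarsideStructure

open GarsideStructure

variable {G : Type*} [Group G]

/-- Convexity of the super summit set: it is closed under `∧` of conjugating elements. -/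
theorem sss_gcd (gs : GarsideStructure G) (x α β : G)
    (hα : α⁻¹ * x * α ∈ gs.SSS x) (hβ : β⁻¹ * x * β ∈ gs.SSS x) :
    (gs.wedge α β)⁻¹ * x * gs.wedge α β ∈ gs.SSS x := by
  by_cases hΔ : gs.Δ = 1
  · rwa [gs.eq_one_of_Delta_eq_one hΔ (gs.wedge α β), ← gs.eq_one_of_Delta_eq_one hΔ α]
  have hinf : gs.ginf (β⁻¹ * x * β) = gs.ginf (α⁻¹ * x * α) :=
    le_antisymm (hα.2 _ ⟨β, rfl⟩).1 (hβ.2 _ ⟨α, rfl⟩).1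
  have hsup : gs.gsup (β⁻¹ * x * β) = gs.gsup (α⁻¹ * x * α) :=
    le_antisymm (hβ.2 _ ⟨α, rfl⟩).2 (hα.2 _ ⟨β, rfl⟩).2
  refine ⟨⟨gs.wedge α β, rfl⟩, fun z hz => ⟨(hα.2 z hz).1.trans ?_, le_trans ?_ (hα.2 z hz).2⟩⟩
  · exact gs.le_ginf hΔ
      (gs.zpow_pre_conj_wedge (gs.ginf_pre hΔ _) (hinf ▸ gs.ginf_pre hΔ (β⁻¹ * x * β)))
  · exact gs.gsup_le hΔ
      (gs.conj_wedge_pre_zpow (gs.pre_gsup hΔ _) (hsup ▸ gs.pre_gsup hΔ (β⁻¹ * x * β)))
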